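/- Let M be a sober MT-algebra and F a Scott-open filter of M. Then ⋀F is a compact saturated element of M. -/

import Mathlib

/-- An MT-algebra: a complete Boolean algebra with an interior operator. -/
structure MTAlg (M : Type*) [CompleteBooleanAlgebra M] where
  box : M → M
  box_top : box ⊤ = ⊤
  box_inf : ∀ a b : M, box (a ⊓ b) = box a ⊓ box b
  box_le : ∀ a : M, box a ≤ a
  box_idem : ∀ a : M, box a ≤ box (box a)

namespace MTAlg

variable {M : Type*} [CompleteBooleanAlgebra M] (T : MTAlg M)

/-- The closure (dual) operator. -/
def dia (a : M) : M := (T.box aᶜ)ᶜ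

/-- Open elements. -/
def IsOpenElem (a : M) : Prop := T.box a = a

/-- Closed elements. -/
def IsClosedElem (a : M) : Prop := T.dia a = a

/-- Saturated elements: meets of open elements. -/
def IsSaturatedElem (a : M) : Prop :=
  ∃ S : Set M, (∀ s ∈ S, T.IsOpenElem s) ∧ a = sInf S

/-- Weakly locally closed elements: meets of a saturated and a closed element. -/
def IsWLC (a : M) : Prop :=
  ∃ s c : M, T.IsSaturatedElem s ∧ T.IsClosedElem c ∧ a = s ⊓ c

/-- T0-algebras: every element is a join of weakly locally closed elements. -/
def IsT0 : Prop :=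
  ∀ a : M, ∃ S : Set M, (∀ b ∈ S, T.IsWLC b) ∧ a = sSup S

/-- T1-algebras: every element is a join of closed elements. -/
def IsT1 : Prop :=
  ∀ a : M, ∃ S : Set M, (∀ b ∈ S, T.IsClosedElem b) ∧ a = sSup S

/-- Join-irreducible elements of the lattice of closed elements. -/
def JoinIrredClosed (p : M) : Prop :=
  T.IsClosedElem p ∧ p ≠ ⊥ ∧
    ∀ a b : M, T.IsClosedElem a → T.IsClosedElem b → p = a ⊔ b → p = a ∨ p = b

/-- Sober MT-algebras. -/
def Sober : Prop :=
  T.IsT0 ∧ ∀ p : M, T.JoinIrredClosed p → ∃ x : M, IsAtom x ∧ p = T.dia x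

/-- Filters of the underlying lattice. -/
def IsFilter (F : Set M) : Prop :=
  ⊤ ∈ F ∧ (∀ a b : M, a ∈ F → a ≤ b → b ∈ F) ∧ (∀ a b : M, a ∈ F → b ∈ F → a ⊓ b ∈ F)

/-- Open filters. -/
def IsOpenFilter (F : Set M) : Prop :=
  IsFilter F ∧ ∀ a ∈ F, T.box a ∈ F

/-- Scott-open filters. -/
def IsScottOpenFilter (F : Set M) : Prop :=
  T.IsOpenFilter F ∧
    ∀ S : Set M, (∀ s ∈ S, T.IsOpenElem s) → S.Nonempty → DirectedOn (· ≤ ·) S →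
      sSup S ∈ F → ∃ s ∈ S, s ∈ F

/-- Compact elements. -/
def IsCompactElem (a : M) : Prop :=
  ∀ S : Set M, (∀ s ∈ S, T.IsOpenElem s) → a ≤ sSup S →
    ∃ t ⊆ S, t.Finite ∧ a ≤ sSup t

/-- The relation `a ◁ b`: there is a compact element between `a` and `b`. -/
def Triangle (a b : M) : Prop := ∃ k : M, T.IsCompactElem k ∧ a ≤ k ∧ k ≤ b

/-- Locally compact MT-algebras. -/
def LocallyCompact : Prop :=
  ∀ u : M, T.IsOpenElem u → u = sSup {v : M | T.IsOpenElem v ∧ T.Triangle v u}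

/-- The way-below relation in the frame of open elements. -/
def WayBelowOpen (a b : M) : Prop :=
  ∀ S : Set M, (∀ s ∈ S, T.IsOpenElem s) → b ≤ sSup S →
    ∃ t ⊆ S, t.Finite ∧ a ≤ sSup t

/-- Elements approximated from above by regular closed elements. -/
def GC (a : M) : Prop :=
  a = sInf {b : M | ∃ c : M, a ≤ T.box c ∧ b = T.dia (T.box c)}

/-- Hausdorff MT-algebras. -/
def IsHausdorff : Prop :=
  ∀ a : M, ∃ S : Set M, (∀ b ∈ S, T.GC b) ∧ a = sSup S

/-- Regular MT-algebras. -/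
def IsRegular : Prop :=
  T.IsT1 ∧ ∀ a : M, T.IsOpenElem a →
    a = sSup {b : M | T.IsOpenElem b ∧ T.dia b ≤ a}

end MTAlg

/-- The atom space of a complete Boolean algebra. -/
abbrev AtomSpace (M : Type*) [CompleteBooleanAlgebra M] : Type _ := {x : M // IsAtom x}

/-- The set of atoms below an element. -/
def eta {M : Type*} [CompleteBooleanAlgebra M] (a : M) : Set (AtomSpace M) :=
  {x : AtomSpace M | x.1 ≤ a}

namespace MTAlg

variable {M : Type*} [CompleteBooleanAlgebra M] (T : MTAlg M)

/-- The topology on the atom space, generated by the images of open elements. -/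
def atTop : TopologicalSpace (AtomSpace M) :=
  TopologicalSpace.generateFrom {U : Set (AtomSpace M) | ∃ u : M, T.IsOpenElem u ∧ U = eta u}

end MTAlg

namespace MTAlg

variable {M : Type*} [CompleteBooleanAlgebra M] {T : MTAlg M}

lemma box_mono (T : MTAlg M) : Monotone T.box := fun a b h => by
  have := T.box_inf a b
  rw [inf_eq_left.2 h] at this
  exact left_eq_inf.1 this

lemma isOpenElem_box (T : MTAlg M) (a : M) : T.IsOpenElem (T.box a) :=
  le_antisymm (T.box_le _) (T.box_idem a)

lemma isOpenElem_sSup {S : Set M} (hS : ∀ s ∈ S, T.IsOpenElem s) : T.IsOpenElem (sSup S) :=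
  le_antisymm (T.box_le _)
    (sSup_le fun s hs => (hS s hs).ge.trans (T.box_mono (le_sSup hs)))

lemma IsOpenElem.isClosedElem_compl {a : M} (ha : T.IsOpenElem a) : T.IsClosedElem aᶜ := by
  rw [IsClosedElem, dia, compl_compl, ha]

lemma IsClosedElem.isOpenElem_compl {a : M} (ha : T.IsClosedElem a) : T.IsOpenElem aᶜ :=
  compl_injective (ha.trans (compl_compl a).symm)

lemma le_dia (T : MTAlg M) (a : M) : a ≤ T.dia a :=
  le_compl_comm.1 (T.box_le aᶜ)

lemma dia_le_compl {a u : M} (hu : T.IsOpenElem u) (h : a ≤ uᶜ) : T.dia a ≤ uᶜ :=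
  compl_le_compl (hu.ge.trans (T.box_mono (le_compl_comm.1 h)))

lemma IsScottOpenFilter.exists_maximal_not_mem {F : Set M} (hF : T.IsScottOpenFilter F) {u : M}
    (hu : T.IsOpenElem u) (huF : u ∉ F) :
    ∃ p, u ≤ p ∧ Maximal (fun v => T.IsOpenElem v ∧ v ∉ F) p := by
  refine zorn_le_nonempty₀ {v | T.IsOpenElem v ∧ v ∉ F} (fun c hc hchain y hy => ?_) u ⟨hu, huF⟩
  refine ⟨sSup c, ⟨isOpenElem_sSup fun s hs => (hc hs).1, fun hmem => ?_⟩, fun z hz => le_sSup hz⟩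
  obtain ⟨s, hs, hsF⟩ := hF.2 c (fun s hs => (hc hs).1) ⟨y, hy⟩ hchain.directedOn hmem
  exact (hc hs).2 hsF

lemma IsFilter.joinIrredClosed_compl {F : Set M} (hF : IsFilter F) {p : M}
    (hp : Maximal (fun v => T.IsOpenElem v ∧ v ∉ F) p) : T.JoinIrredClosed pᶜ := by
  obtain ⟨htop, -, hinf⟩ := hF
  refine ⟨hp.prop.1.isClosedElem_compl, fun h => hp.prop.2 (compl_eq_bot.1 h ▸ htop),
    fun a b ha hb hab => ?_⟩
  have mem_of_ne {c : M} (hc : T.IsClosedElem c) (hcp : c ≤ pᶜ) (hne : pᶜ ≠ c) : cᶜ ∈ F := by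
    by_contra hcF
    have := hp.eq_of_le ⟨hc.isOpenElem_compl, hcF⟩ (le_compl_comm.1 hcp)
    exact hne (by rw [this, compl_compl])
  by_contra! hne
  refine hp.prop.2 ?_
  rw [← compl_compl p, hab, compl_sup]
  exact hinf _ _ (mem_of_ne ha (hab ▸ le_sup_left) hne.1) (mem_of_ne hb (hab ▸ le_sup_right) hne.2)

lemma IsScottOpenFilter.mem_of_sInf_le (hsob : T.Sober) {F : Set M} (hF : T.IsScottOpenFilter F)
    {u : M} (hu : T.IsOpenElem u) (h : sInf F ≤ u) : u ∈ F := by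
  by_contra huF
  obtain ⟨p, hup, hp⟩ := hF.exists_maximal_not_mem hu huF
  obtain ⟨x, hx, hpx⟩ := hsob.2 _ (hF.1.1.joinIrredClosed_compl hp)
  have hxF : x ≤ sInf F := le_sInf fun a ha => by
    refine le_trans ?_ (T.box_le a)
    by_contra hxa
    have hxc : x ≤ (T.box a)ᶜ := le_compl_iff_disjoint_right.2 (hx.not_le_iff_disjoint.1 hxa)
    have hpa : pᶜ ≤ (T.box a)ᶜ := hpx ▸ dia_le_compl (T.isOpenElem_box a) hxc
    exact hp.prop.2 (hF.1.1.2.1 _ _ (hF.1.2 a ha) (compl_le_compl_iff_le.1 hpa))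
  have hxp : x ≤ pᶜ := hpx ▸ T.le_dia x
  exact hx.1 (le_bot_iff.1 (inf_compl_self p ▸ le_inf (hxF.trans (h.trans hup)) hxp))

lemma IsOpenFilter.isSaturatedElem_sInf {F : Set M} (hF : T.IsOpenFilter F) :
    T.IsSaturatedElem (sInf F) := by
  refine ⟨T.box '' F, ?_, le_antisymm ?_ ?_⟩
  · rintro _ ⟨a, -, rfl⟩
    exact T.isOpenElem_box a
  · refine le_sInf ?_
    rintro _ ⟨a, ha, rfl⟩
    exact sInf_le (hF.2 a ha)
  · exact le_sInf fun a ha => (sInf_le (Set.mem_image_of_mem _ ha)).trans (T.box_le a)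

lemma IsScottOpenFilter.exists_finite_sSup_mem {F : Set M} (hF : T.IsScottOpenFilter F)
    {S : Set M} (hS : ∀ s ∈ S, T.IsOpenElem s) (h : sSup S ∈ F) :
    ∃ t ⊆ S, t.Finite ∧ sSup t ∈ F := by
  suffices ∃ s ∈ sSup '' {t | t ⊆ S ∧ t.Finite}, s ∈ F by
    obtain ⟨_, ⟨t, ⟨htS, ht⟩, rfl⟩, htF⟩ := this
    exact ⟨t, htS, ht, htF⟩
  refine hF.2 _ ?_ ?_ ?_ ?_
  · rintro _ ⟨t, ⟨htS, -⟩, rfl⟩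
    exact isOpenElem_sSup fun s hs => hS s (htS hs)
  · exact ⟨_, ∅, ⟨Set.empty_subset S, Set.finite_empty⟩, rfl⟩
  · rintro _ ⟨t, ⟨htS, ht⟩, rfl⟩ _ ⟨r, ⟨hrS, hr⟩, rfl⟩
    exact ⟨_, ⟨t ∪ r, ⟨Set.union_subset htS hrS, ht.union hr⟩, rfl⟩,
      sSup_le_sSup Set.subset_union_left, sSup_le_sSup Set.subset_union_right⟩
  · refine hF.1.1.2.1 _ _ h (sSup_le fun s hs => le_sSup ⟨{s}, ⟨?_, Set.finite_singleton s⟩, ?_⟩)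
    · exact Set.singleton_subset_iff.2 hs
    · exact sSup_singleton

end MTAlg

/-- In a sober MT-algebra, the meet of a Scott-open filter is compact saturated. -/
theorem sInf_scottOpenFilter_compact_saturated {M : Type*} [CompleteBooleanAlgebra M]
    (T : MTAlg M) (hsob : T.Sober) (F : Set M) (hF : T.IsScottOpenFilter F) :
    T.IsCompactElem (sInf F) ∧ T.IsSaturatedElem (sInf F) := by
  refine ⟨fun S hS hle => ?_, hF.1.isSaturatedElem_sInf⟩
  obtain ⟨t, htS, ht, htF⟩ := hF.exists_finite_sSup_mem hS
    (hF.mem_of_sInf_le hsob (MTAlg.isOpenElem_sSup hS) hle)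
  exact ⟨t, htS, ht, sInf_le htF⟩
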